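/- Let P be a set, Γ an additive abelian group, and T ⊆ Γ a submonoid with T ∩ (−T) = {0} which generates Γ as a group and such that T is atomic. Let D = F(P) × T (so D is a reduced monoid), assume D is atomic, and let H ⊆ D be a submonoid such that the inclusion H ↪ D is a cofinal divisor homomorphism. Let G = (q(F) × Γ)/q(H) be the class group of the inclusion, G_P = {[(p,0)] : p ∈ P} ⊆ G, and ι: T → G the map t ↦ [(0,t)]. Set B = {(S,t) ∈ F(G_P) × T : σ(S) + ι(t) = 0}, a submonoid of F(G_P) × T, and define β: H → F(G_P) × T by β(x,t) = (the multiset containing [(p,0)] with multiplicity x(p) for each p ∈ P, t). Then β maps H into B and β: H → B is a transfer homomorphism. -/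

import Mathlib

/-- An atom (irreducible element) of an additive commutative monoid. -/
def IsAddAtom {M : Type*} [AddCommMonoid M] (u : M) : Prop :=
  ¬ IsAddUnit u ∧ ∀ b c : M, u = b + c → IsAddUnit b ∨ IsAddUnit c

/-- An additive monoid is atomic if every non-unit is a finite sum of atoms. -/
def AddAtomic (M : Type*) [AddCommMonoid M] : Prop :=
  ∀ a : M, ¬ IsAddUnit a → ∃ l : List M, (∀ x ∈ l, IsAddAtom x) ∧ l.sum = a

/-- A transfer homomorphism between reduced commutative (additive) monoids:
surjective, trivial kernel as a preimage of `0`, and factorizations lift. -/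
def IsTransferHomAdd {M N : Type*} [AddCommMonoid M] [AddCommMonoid N] (θ : M →+ N) : Prop :=
  Function.Surjective θ ∧ (∀ a : M, θ a = 0 → a = 0) ∧
    ∀ (u : M) (b c : N), θ u = b + c → ∃ v w : M, u = v + w ∧ θ v = b ∧ θ w = c

/-- The canonical embedding of the free abelian monoid `F(P)` into its quotient group
`q(F)`, i.e. of `P →₀ ℕ` into `P →₀ ℤ`. -/
noncomputable def toIntF {P : Type*} : (P →₀ ℕ) →+ (P →₀ ℤ) :=
  Finsupp.mapRange.addMonoidHom (Nat.castAddMonoidHom ℤ)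

variable {P : Type*} {Γ : Type*} [AddCommGroup Γ]

/-- The embedding of `D = F(P) × T` into `q(F) × Γ`. -/
noncomputable def embD (T : AddSubmonoid Γ) : ((P →₀ ℕ) × ↥T) →+ ((P →₀ ℤ) × Γ) :=
  AddMonoidHom.prodMap toIntF T.subtype

/-- The quotient group `q(H)` of `H ⊆ D`, as a subgroup of `q(F) × Γ`. -/
noncomputable def qHD (T : AddSubmonoid Γ) (H : AddSubmonoid ((P →₀ ℕ) × ↥T)) :
    AddSubgroup ((P →₀ ℤ) × Γ) :=
  AddSubgroup.closure (⇑(embD T) '' (H : Set ((P →₀ ℕ) × ↥T)))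

/-- The class group `G = (q(F) × Γ)/q(H)` of the inclusion `H ↪ D`. -/
abbrev ClassGrpD (T : AddSubmonoid Γ) (H : AddSubmonoid ((P →₀ ℕ) × ↥T)) : Type _ :=
  ((P →₀ ℤ) × Γ) ⧸ qHD T H

/-- The canonical projection onto the class group. -/
noncomputable def clsD (T : AddSubmonoid Γ) (H : AddSubmonoid ((P →₀ ℕ) × ↥T)) :
    ((P →₀ ℤ) × Γ) →+ ClassGrpD T H :=
  QuotientAddGroup.mk' (qHD T H)

/-- The set `G_P = {[(p, 0)] : p ∈ P}` of classes containing primes. -/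
def GPD (T : AddSubmonoid Γ) (H : AddSubmonoid ((P →₀ ℕ) × ↥T)) : Set (ClassGrpD T H) :=
  {g | ∃ p : P, g = clsD T H (Finsupp.single p 1, 0)}

/-- The map `ι : T → G`, `t ↦ [(0, t)]`. -/
noncomputable def iotaD (T : AddSubmonoid Γ) (H : AddSubmonoid ((P →₀ ℕ) × ↥T)) :
    ↥T →+ ClassGrpD T H :=
  (clsD T H).comp ((AddMonoidHom.inr (P →₀ ℤ) Γ).comp T.subtype)

/-- The `T`-block monoid `B = B(G_P, T, ι) = {(S, t) : σ(S) + ι(t) = 0}`, a submonoid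
of `F(G_P) × T`. -/
noncomputable def TBlockSub (T : AddSubmonoid Γ) (H : AddSubmonoid ((P →₀ ℕ) × ↥T)) :
    AddSubmonoid (Multiset (ClassGrpD T H) × ↥T) where
  carrier := {St | (∀ x ∈ St.1, x ∈ GPD T H) ∧ St.1.sum + iotaD T H St.2 = 0}
  zero_mem' := by
    refine ⟨fun x hx => absurd hx (Multiset.notMem_zero x), ?_⟩
    simp
  add_mem' := by
    rintro a b ⟨ha1, ha2⟩ ⟨hb1, hb2⟩
    refine ⟨fun x hx => ?_, ?_⟩
    · rcases Multiset.mem_add.mp hx with h | h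
      exacts [ha1 x h, hb1 x h]
    · show (a.1 + b.1).sum + iotaD T H (a.2 + b.2) = 0
      rw [Multiset.sum_add, map_add, add_add_add_comm, ha2, hb2, add_zero]

/-- The block map `β : D → F(G_P) × T`. -/
noncomputable def betaD (T : AddSubmonoid Γ) (H : AddSubmonoid ((P →₀ ℕ) × ↥T))
    (d : (P →₀ ℕ) × ↥T) : Multiset (ClassGrpD T H) × ↥T :=
  (d.1.sum fun p n => Multiset.replicate n (clsD T H (Finsupp.single p 1, 0)), d.2)

/-- If the image of a multiset under a map splits as a sum, so does the multiset. -/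
theorem Multiset.exists_add_of_map_eq_add {α β : Type*} (f : α → β) (b c : Multiset β)
    (s : Multiset α) (h : s.map f = b + c) :
    ∃ s₁ s₂ : Multiset α, s = s₁ + s₂ ∧ s₁.map f = b ∧ s₂.map f = c := by
  classical
  induction b using Multiset.induction_on generalizing s with
  | empty => exact ⟨0, s, by simp, by simp, by simpa using h⟩
  | cons a b ih =>
    rw [Multiset.cons_add] at h
    obtain ⟨x, hx, rfl, hs⟩ := (Multiset.map_eq_cons f s (b + c) a).mpr h
    obtain ⟨s₁, s₂, hsum, rfl, rfl⟩ := ih _ hs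
    exact ⟨x ::ₘ s₁, s₂, by rw [Multiset.cons_add, ← hsum, Multiset.cons_erase hx],
      by simp, rfl⟩

/-- Every element of the subgroup generated by a submonoid is a difference of two of its
elements. -/
theorem AddSubmonoid.exists_sub_of_mem_closure {M A : Type*} [AddCommMonoid M] [AddCommGroup A]
    (f : M →+ A) (H : AddSubmonoid M) {z : A}
    (hz : z ∈ AddSubgroup.closure (f '' (H : Set M))) :
    ∃ a ∈ H, ∃ b ∈ H, z = f a - f b := by
  induction hz using AddSubgroup.closure_induction with
  | mem x hx =>
    obtain ⟨a, ha, rfl⟩ := hx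
    exact ⟨a, ha, 0, H.zero_mem, by simp⟩
  | zero => exact ⟨0, H.zero_mem, 0, H.zero_mem, by simp⟩
  | add x y _ _ hx hy =>
    obtain ⟨a, ha, b, hb, rfl⟩ := hx
    obtain ⟨c, hc, d, hd, rfl⟩ := hy
    exact ⟨a + c, H.add_mem ha hc, b + d, H.add_mem hb hd, by
      rw [map_add, map_add, add_sub_add_comm]⟩
  | neg x _ hx =>
    obtain ⟨a, ha, b, hb, rfl⟩ := hx
    exact ⟨b, hb, a, ha, neg_sub _ _⟩

theorem embD_injective (T : AddSubmonoid Γ) :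
    Function.Injective (embD (P := P) T) := by
  rintro ⟨x, s⟩ ⟨y, t⟩ h
  obtain ⟨hxy, hst⟩ := Prod.mk.inj h
  refine Prod.ext (Finsupp.mapRange_injective _ Nat.cast_zero Nat.cast_injective hxy) ?_
  exact Subtype.ext hst

theorem betaD_eq (T : AddSubmonoid Γ) (H : AddSubmonoid ((P →₀ ℕ) × ↥T))
    (d : (P →₀ ℕ) × ↥T) :
    betaD T H d =
      ((Finsupp.toMultiset d.1).map fun p => clsD T H (Finsupp.single p 1, 0), d.2) := by
  refine Prod.ext ?_ rfl
  rw [Finsupp.toMultiset_map, Finsupp.toMultiset_apply,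
    Finsupp.sum_mapDomain_index (by simp) (by simp [add_smul])]
  simp [betaD, Multiset.nsmul_singleton]

theorem betaD_add (T : AddSubmonoid Γ) (H : AddSubmonoid ((P →₀ ℕ) × ↥T))
    (d e : (P →₀ ℕ) × ↥T) : betaD T H (d + e) = betaD T H d + betaD T H e := by
  simp [betaD_eq]

theorem betaD_sum_add_iotaD (T : AddSubmonoid Γ) (H : AddSubmonoid ((P →₀ ℕ) × ↥T))
    (d : (P →₀ ℕ) × ↥T) :
    (betaD T H d).1.sum + iotaD T H d.2 = clsD T H (embD T d) := by
  obtain ⟨x, t⟩ := d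
  have hx : (betaD T H (x, t)).1.sum = clsD T H (toIntF x, 0) := by
    induction x using Finsupp.induction_linear with
    | zero => rw [betaD_eq]; simp [← Prod.zero_eq_mk]
    | add x y hx hy =>
      have hadd : ((toIntF (x + y), 0) : (P →₀ ℤ) × Γ) = (toIntF x, 0) + (toIntF y, 0) := by
        simp
      rw [hadd, map_add, ← hx, ← hy, betaD_eq, betaD_eq, betaD_eq]
      simp
    | single p n =>
      have hsingle : ((toIntF (Finsupp.single p n), 0) : (P →₀ ℤ) × Γ)
          = n • (Finsupp.single p 1, 0) := by
        simp [toIntF]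
      rw [hsingle, map_nsmul, betaD_eq]
      simp [Finsupp.toMultiset_single, Multiset.map_nsmul, Multiset.sum_nsmul]
  have hsplit : embD T (x, t) = (toIntF x, 0) + (0, (t : Γ)) := by
    simp [embD]
  rw [hx, hsplit, map_add]
  rfl

/-- For a divisor homomorphism `H ↪ D`, the elements of `D` of trivial class are those of `H`. -/
theorem clsD_embD_eq_zero_iff (T : AddSubmonoid Γ) (H : AddSubmonoid ((P →₀ ℕ) × ↥T))
    (hdiv : ∀ a b : (P →₀ ℕ) × ↥T, a ∈ H → b ∈ H → a.1 ≤ b.1 →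
      ∀ h2 : ((b.2 : Γ) - (a.2 : Γ)) ∈ T,
        ((b.1 - a.1, ⟨(b.2 : Γ) - (a.2 : Γ), h2⟩) : (P →₀ ℕ) × ↥T) ∈ H)
    (d : (P →₀ ℕ) × ↥T) : clsD T H (embD T d) = 0 ↔ d ∈ H := by
  rw [clsD, QuotientAddGroup.mk'_apply, QuotientAddGroup.eq_zero_iff]
  refine ⟨fun hd => ?_, fun hd => AddSubgroup.subset_closure ⟨d, hd, rfl⟩⟩
  obtain ⟨a, ha, b, hb, hab⟩ := AddSubmonoid.exists_sub_of_mem_closure _ _ hd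
  obtain rfl : d + b = a := embD_injective T (by rw [map_add, hab, sub_add_cancel])
  have hsub : (((d + b).2 : Γ) - (b.2 : Γ)) = d.2 := by simp
  convert hdiv b (d + b) hb ha (by simp) (hsub ▸ d.2.2) using 1
  exact Prod.ext (by simp) (Subtype.ext hsub.symm)

theorem betaD_mem_TBlockSub_iff (T : AddSubmonoid Γ) (H : AddSubmonoid ((P →₀ ℕ) × ↥T))
    (hdiv : ∀ a b : (P →₀ ℕ) × ↥T, a ∈ H → b ∈ H → a.1 ≤ b.1 →
      ∀ h2 : ((b.2 : Γ) - (a.2 : Γ)) ∈ T,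
        ((b.1 - a.1, ⟨(b.2 : Γ) - (a.2 : Γ), h2⟩) : (P →₀ ℕ) × ↥T) ∈ H)
    (d : (P →₀ ℕ) × ↥T) : betaD T H d ∈ TBlockSub T H ↔ d ∈ H := by
  rw [← clsD_embD_eq_zero_iff T H hdiv, ← betaD_sum_add_iotaD]
  refine ⟨fun h => h.2, fun h => ⟨fun g hg => ?_, h⟩⟩
  rw [betaD_eq] at hg
  obtain ⟨p, -, rfl⟩ := Multiset.mem_map.mp hg
  exact ⟨p, rfl⟩

open Classical in
theorem betaD_toFinsupp (T : AddSubmonoid Γ) (H : AddSubmonoid ((P →₀ ℕ) × ↥T))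
    (s : Multiset P) (t : ↥T) :
    betaD T H (Multiset.toFinsupp s, t) =
      (s.map fun p => clsD T H (Finsupp.single p 1, 0), t) := by
  rw [betaD_eq, Multiset.toFinsupp_toMultiset]

/-- Let `T ⊆ Γ` be a reduced atomic submonoid generating `Γ`,
`D = F(P) × T` atomic, and `H ⊆ D` a submonoid such that `H ↪ D` is a cofinal divisor
homomorphism with class group `G`. Then `β` maps `H` into the `T`-block monoid
`B = B(G_P, T, ι)`, and `β : H → B` is a transfer homomorphism. -/
theorem t_block_transfer (T : AddSubmonoid Γ)
    (hred : ∀ t ∈ T, -t ∈ T → t = 0)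
    (hgen : AddSubgroup.closure (T : Set Γ) = ⊤)
    (hTatomic : AddAtomic ↥T)
    (H : AddSubmonoid ((P →₀ ℕ) × ↥T))
    (hDatomic : AddAtomic ((P →₀ ℕ) × ↥T))
    (hdiv : ∀ a b : (P →₀ ℕ) × ↥T, a ∈ H → b ∈ H → a.1 ≤ b.1 →
      ∀ h2 : ((b.2 : Γ) - (a.2 : Γ)) ∈ T,
        ((b.1 - a.1, ⟨(b.2 : Γ) - (a.2 : Γ), h2⟩) : (P →₀ ℕ) × ↥T) ∈ H)
    (hcof : ∀ d : (P →₀ ℕ) × ↥T, ∃ h ∈ H, d.1 ≤ h.1 ∧ ((h.2 : Γ) - (d.2 : Γ)) ∈ T) :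
    (∀ h ∈ H, betaD T H h ∈ TBlockSub T H) ∧
    ∃ θ : ↥H →+ ↥(TBlockSub T H),
      (∀ h : ↥H, (θ h : Multiset (ClassGrpD T H) × ↥T) = betaD T H (h : (P →₀ ℕ) × ↥T)) ∧
      IsTransferHomAdd θ := by
  classical
  have hmem := betaD_mem_TBlockSub_iff T H hdiv
  let θ : ↥H →+ ↥(TBlockSub T H) :=
    { toFun := fun h => ⟨betaD T H h, (hmem h).mpr h.2⟩
      map_zero' := Subtype.ext (by simp [betaD_eq, ← Prod.zero_eq_mk])
      map_add' := fun a b => Subtype.ext (betaD_add T H a b) }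
  refine ⟨fun h hh => (hmem h).mpr hh, θ, fun _ => rfl, ?_, ?_, ?_⟩
  · rintro ⟨⟨S, t⟩, hS⟩
    obtain ⟨s, rfl⟩ : ∃ s : Multiset P,
        s.map (fun p => clsD T H (Finsupp.single p 1, 0)) = S := by
      choose g hg using hS.1
      refine ⟨S.attach.map fun x => g x.1 x.2, ?_⟩
      rw [Multiset.map_map]
      exact (Multiset.map_congr rfl fun x _ => (hg x.1 x.2).symm).trans S.attach_map_val
    rw [← betaD_toFinsupp] at hS
    exact ⟨⟨_, (hmem _).mp hS⟩, Subtype.ext (betaD_toFinsupp T H s t)⟩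
  · rintro ⟨⟨x, t⟩, hxt⟩ h
    have hβ : betaD T H (x, t) = 0 := congrArg Subtype.val h
    rw [betaD_eq] at hβ
    obtain ⟨hx, ht⟩ := Prod.mk.inj hβ
    refine Subtype.ext (Prod.ext ?_ ht)
    exact Multiset.toFinsupp.symm.injective
      ((Multiset.map_eq_zero.mp hx).trans (map_zero Finsupp.toMultiset).symm)
  · rintro ⟨⟨x, t⟩, hxt⟩ ⟨⟨B, b⟩, hB⟩ ⟨⟨C, c⟩, hC⟩ h
    have hβ : betaD T H (x, t) = (B, b) + (C, c) := congrArg Subtype.val h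
    rw [betaD_eq] at hβ
    obtain ⟨hx, rfl⟩ := Prod.mk.inj hβ
    obtain ⟨s₁, s₂, hs, rfl, rfl⟩ := Multiset.exists_add_of_map_eq_add _ _ _ _ hx
    rw [← betaD_toFinsupp] at hB hC
    refine ⟨⟨_, (hmem _).mp hB⟩, ⟨_, (hmem _).mp hC⟩, Subtype.ext (Prod.ext ?_ rfl),
      Subtype.ext (betaD_toFinsupp T H _ _), Subtype.ext (betaD_toFinsupp T H _ _)⟩
    change x = Multiset.toFinsupp s₁ + Multiset.toFinsupp s₂
    rw [← map_add, ← hs, Finsupp.toMultiset_toFinsupp]
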